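/- Let X be a Hilbert space and let f : X → ℝ ∪ {+∞} be a proper lower semicontinuous function that is subdifferentially continuous at x̄ ∈ dom f for x̄* = 0 ∈ ∂f(x̄). Then the following are equivalent: (vi) f is prox-regular at x̄ for 0 and x̄ is a tilt-stable local minimizer of f with modulus κ > 0; (v) ∂f is metrically regular around (x̄, 0) with modulus κ and there exist r ∈ [0, κ⁻¹) and neighborhoods U of x̄ and U* of 0 such that f(x) ≥ f(u) + ⟨u*, x − u⟩ − (r/2)·‖x − u‖² for all x ∈ U and all (u, u*) ∈ gph ∂f ∩ (U × U*). -/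

import Mathlib

open Filter Metric Topology RealInnerProductSpace

noncomputable section

variable {X : Type*} [NormedAddCommGroup X] [InnerProductSpace ℝ X]

/-- The regular/Fréchet subdifferential of `f` at `x` (Hilbert-space setting). -/
def FrechetSubdiff (f : X → EReal) (x : X) : Set X :=
  {p | f x ≠ ⊤ ∧ ∀ ε : ℝ, 0 < ε → ∃ δ : ℝ, 0 < δ ∧
    ∀ y : X, ‖y - x‖ < δ → f x + ((⟪p, y - x⟫ - ε * ‖y - x‖ : ℝ) : EReal) ≤ f y}

/-- The limiting subdifferential of `f` at `x`: sequential weak outer limit of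
Fréchet subdifferentials. -/
def LimitingSubdiff (f : X → EReal) (x : X) : Set X :=
  {p | ∃ (xs ps : ℕ → X),
    (∀ k, ps k ∈ FrechetSubdiff f (xs k)) ∧
    Tendsto xs atTop (𝓝 x) ∧
    Tendsto (fun k => f (xs k)) atTop (𝓝 (f x)) ∧
    (∀ v : X, Tendsto (fun k => ⟪ps k, v⟫) atTop (𝓝 ⟪p, v⟫))}

def MetricallySubregularAt {A B : Type*} [PseudoMetricSpace A] [PseudoMetricSpace B]
    (F : A → Set B) (xb : A) (yb : B) (κ : ℝ) : Prop :=
  ∃ U ∈ 𝓝 xb, ∀ x ∈ U,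
    EMetric.infEdist x {z | yb ∈ F z} ≤ ENNReal.ofReal κ * EMetric.infEdist yb (F x)

def StronglyMetricallySubregularAt {A B : Type*} [PseudoMetricSpace A] [PseudoMetricSpace B]
    (F : A → Set B) (xb : A) (yb : B) (κ : ℝ) : Prop :=
  ∃ U ∈ 𝓝 xb, (∀ x ∈ U,
    EMetric.infEdist x {z | yb ∈ F z} ≤ ENNReal.ofReal κ * EMetric.infEdist yb (F x)) ∧
    {z | yb ∈ F z} ∩ U = {xb}

def MetricallyRegularAround {A B : Type*} [PseudoMetricSpace A] [PseudoMetricSpace B]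
    (F : A → Set B) (xb : A) (yb : B) (κ : ℝ) : Prop :=
  ∃ U ∈ 𝓝 xb, ∃ V ∈ 𝓝 yb, ∀ x ∈ U, ∀ y ∈ V,
    EMetric.infEdist x {z | y ∈ F z} ≤ ENNReal.ofReal κ * EMetric.infEdist y (F x)

def StronglyMetricallyRegularAround {A B : Type*} [PseudoMetricSpace A] [PseudoMetricSpace B]
    (F : A → Set B) (xb : A) (yb : B) (κ : ℝ) : Prop :=
  MetricallyRegularAround F xb yb κ ∧
  ∃ V ∈ 𝓝 yb, ∃ U ∈ 𝓝 xb, ∀ y ∈ V, ∃! x, x ∈ U ∧ y ∈ F x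

/-- `f` is subdifferentially continuous at `xb` for `pb`: the map `(x, p) ↦ f x` is
continuous at `(xb, pb)` relative to the graph of the limiting subdifferential. -/
def SubdiffContAt (f : X → EReal) (xb pb : X) : Prop :=
  Tendsto (fun q : X × X => f q.1)
    (𝓝[{q : X × X | q.2 ∈ LimitingSubdiff f q.1}] (xb, pb)) (𝓝 (f xb))

/-- `f` is prox-regular at `xb` for `pb`. -/
def ProxRegularAt (f : X → EReal) (xb pb : X) : Prop :=
  f xb ≠ ⊤ ∧ ∃ r : ℝ, 0 < r ∧ ∃ ε : ℝ, 0 < ε ∧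
    ∀ x ∈ Metric.closedBall xb ε, ∀ u ∈ Metric.closedBall xb ε,
      f u ≤ f xb + (ε : EReal) → f xb ≤ f u + (ε : EReal) →
      ∀ p ∈ LimitingSubdiff f u, p ∈ Metric.closedBall pb ε →
        f u + ((⟪p, x - u⟫ - r / 2 * ‖x - u‖ ^ 2 : ℝ) : EReal) ≤ f x

/-- The set of minimizers of the tilted function `x ↦ f x - ⟪p, x⟫` over the
closed ball of radius `γ` around `xb`. -/
def TiltArgmin (f : X → EReal) (xb : X) (γ : ℝ) (p : X) : Set X :=
  {x | x ∈ Metric.closedBall xb γ ∧ ∀ y ∈ Metric.closedBall xb γ,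
    f x - ((⟪p, x⟫ : ℝ) : EReal) ≤ f y - ((⟪p, y⟫ : ℝ) : EReal)}

/-- `xb` is a tilt-stable local minimizer of `f` with modulus `κ`. -/
def TiltStableWith (f : X → EReal) (xb : X) (κ : ℝ) : Prop :=
  ∃ γ : ℝ, 0 < γ ∧ ∃ V ∈ 𝓝 (0 : X), ∃ m : X → X,
    (∀ p ∈ V, TiltArgmin f xb γ p = {m p}) ∧
    LipschitzOnWith (Real.toNNReal κ) m V ∧ m 0 = xb

/-- `xb` is a tilt-stable local minimizer of `f`. -/
def TiltStable (f : X → EReal) (xb : X) : Prop :=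
  ∃ γ : ℝ, 0 < γ ∧ ∃ V ∈ 𝓝 (0 : X), ∃ m : X → X, ∃ K : NNReal,
    (∀ p ∈ V, TiltArgmin f xb γ p = {m p}) ∧
    LipschitzOnWith K m V ∧ m 0 = xb

theorem exists_real_of_ne {f : X → EReal} (hbot : ∀ x, f x ≠ ⊥) {x : X} (h : f x ≠ ⊤) :
    ∃ a : ℝ, f x = (a : EReal) :=
  ⟨(f x).toReal, (EReal.coe_toReal h (hbot x)).symm⟩

theorem frechet_subset_limiting {f : X → EReal} {x p : X} (h : p ∈ FrechetSubdiff f x) :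
    p ∈ LimitingSubdiff f x :=
  ⟨fun _ => x, fun _ => p, fun _ => h, tendsto_const_nhds, tendsto_const_nhds,
    fun _ => tendsto_const_nhds⟩

/-- Local uniform quadratic lower estimate with constant `r` (of any sign). -/
def GrowthNear (f : X → EReal) (xb : X) (r : ℝ) : Prop :=
  ∃ ε : ℝ, 0 < ε ∧ ∀ x u : X, ‖x - xb‖ < ε → ‖u - xb‖ < ε →
    ∀ q ∈ LimitingSubdiff f u, ‖q‖ < ε →
      f u + ((⟪q, x - u⟫ - r / 2 * ‖x - u‖ ^ 2 : ℝ) : EReal) ≤ f x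

/-- Selection form of metric regularity. -/
def SelNear (f : X → EReal) (xb : X) (κ : ℝ) : Prop :=
  ∃ ε : ℝ, 0 < ε ∧ ∀ u : X, ‖u - xb‖ < ε → ∀ y ∈ LimitingSubdiff f u,
    ∀ y' : X, ‖y'‖ < ε → ∀ a : ℝ, κ * ‖y' - y‖ < a →
      ∃ w : X, y' ∈ LimitingSubdiff f w ∧ ‖w - u‖ < a

theorem GrowthNear.mono {f : X → EReal} {xb : X} {r s : ℝ} (h : GrowthNear f xb r)
    (hrs : r ≤ s) : GrowthNear f xb s := by
  obtain ⟨ε, hε, h⟩ := h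
  refine ⟨ε, hε, fun x u hx hu q hq hqε => le_trans ?_ (h x u hx hu q hq hqε)⟩
  gcongr

theorem selNear_of_metricallyRegular {f : X → EReal} {xb : X} {κ : ℝ} (hκ : 0 < κ)
    (h : MetricallyRegularAround (LimitingSubdiff f) xb (0 : X) κ) : SelNear f xb κ := by
  obtain ⟨U, hU, V, hV, h⟩ := h
  obtain ⟨e1, he1, h1⟩ := Metric.mem_nhds_iff.1 hU
  obtain ⟨e2, he2, h2⟩ := Metric.mem_nhds_iff.1 hV
  refine ⟨min e1 e2, lt_min he1 he2, fun u hu y hy y' hy' a ha => ?_⟩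
  have hu' : u ∈ U := h1 (by
    rw [Metric.mem_ball, dist_eq_norm]; exact hu.trans_le (min_le_left _ _))
  have hy'' : y' ∈ V := h2 (by
    rw [Metric.mem_ball, dist_zero_right]; exact hy'.trans_le (min_le_right _ _))
  have hle := h u hu' y' hy''
  have hlt : Metric.infEDist u {z | y' ∈ LimitingSubdiff f z} < ENNReal.ofReal a := by
    refine lt_of_le_of_lt hle ?_
    calc ENNReal.ofReal κ * Metric.infEDist y' (LimitingSubdiff f u)
        ≤ ENNReal.ofReal κ * edist y' y := by
          gcongr
          exact Metric.infEDist_le_edist_of_mem hy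
      _ = ENNReal.ofReal (κ * ‖y' - y‖) := by
          rw [edist_dist, dist_eq_norm, ENNReal.ofReal_mul hκ.le]
      _ < ENNReal.ofReal a := by
          rw [ENNReal.ofReal_lt_ofReal_iff_of_nonneg (by positivity)]
          exact ha
  obtain ⟨w, hw, hd⟩ := Metric.infEDist_lt_iff.1 hlt
  refine ⟨w, hw, ?_⟩
  rw [edist_dist, ENNReal.ofReal_lt_ofReal_iff_of_nonneg dist_nonneg, dist_comm,
    dist_eq_norm] at hd
  exact hd

theorem step_ineq {κ r θ : ℝ} (hκ : 0 < κ) (hr : 0 ≤ r) (hrκ : r * κ < 1)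
    (hθ : θ = (1 - r * κ) / (4 * κ)) {H W I : ℝ} (hH : 0 ≤ H) (hW : 0 ≤ W)
    (hWH : W ≤ κ * θ * H) (hI : |I| ≤ H * W) :
    (1 - r * κ) ^ 2 / (8 * κ) * H ^ 2 ≤ θ * H ^ 2 - (θ - r) * I - r * W ^ 2 := by
  have hθ0 : 0 < θ := by rw [hθ]; apply div_pos <;> nlinarith
  have hG : 4 * (κ * θ) = 1 - r * κ := by rw [hθ]; field_simp
  have e : (1 - r * κ) ^ 2 / (8 * κ) = θ * (1 - r * κ) / 2 := by rw [hθ]; field_simp; ring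
  rw [e]
  have h1 : (θ - r) * I ≤ (θ + r) * (H * W) := by
    calc (θ - r) * I ≤ |(θ - r) * I| := le_abs_self _
      _ = |θ - r| * |I| := abs_mul _ _
      _ ≤ (θ + r) * (H * W) := by
        apply mul_le_mul _ hI (abs_nonneg _) (by positivity)
        rw [abs_le]; constructor <;> linarith
  have h2 : H * W ≤ κ * θ * H ^ 2 := by nlinarith
  have h3 : W ^ 2 ≤ (κ * θ) ^ 2 * H ^ 2 := by
    calc W ^ 2 ≤ (κ * θ * H) ^ 2 := by gcongr
      _ = _ := by ring
  have h4 : (θ + r) * (H * W) ≤ (θ + r) * (κ * θ * H ^ 2) := by gcongr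
  have h5 : r * W ^ 2 ≤ r * ((κ * θ) ^ 2 * H ^ 2) := by gcongr
  have h6 : θ * (1 - r * κ) / 2 ≤ θ - (θ + r) * (κ * θ) - r * (κ * θ) ^ 2 := by
    have : θ - (θ + r) * (κ * θ) - r * (κ * θ) ^ 2 - θ * (1 - r * κ) / 2
      = θ * (1 - r * κ) * ((1 - r * κ) / 4) := by
      have e1 : θ - (θ + r) * (κ * θ) - r * (κ * θ) ^ 2 - θ * (1 - r * κ) / 2
        = θ * ((1 - r * κ) / 2 - (κ * θ) * (1 + r * κ)) := by ring
      have e2 : κ * θ = (1 - r * κ) / 4 := by linarith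
      rw [e1, e2]; ring
    have : 0 ≤ θ * (1 - r * κ) * ((1 - r * κ) / 4) := by
      have : 0 < 1 - r * κ := by linarith
      positivity
    linarith
  have h7 := mul_le_mul_of_nonneg_right h6 (sq_nonneg H)
  nlinarith

theorem growth_step {f : X → EReal} (hbot : ∀ x, f x ≠ ⊥) {xb : X} (hfin : f xb ≠ ⊤)
    {κ κ' r : ℝ} (hκ : 0 < κ) (hκκ : κ < κ') (hr : 0 ≤ r) (hrκ : r * κ' < 1)
    (hsel : SelNear f xb κ) (hg : GrowthNear f xb r) :
    GrowthNear f xb (r - (1 - r * κ') ^ 2 / (4 * κ')) := by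
  obtain ⟨e1, he1, h1⟩ := hg
  obtain ⟨e2, he2, h2⟩ := hsel
  have hκ' : 0 < κ' := hκ.trans hκκ
  obtain ⟨θ, hθ⟩ : ∃ θ : ℝ, θ = (1 - r * κ') / (4 * κ') := ⟨_, rfl⟩
  have hθ0 : 0 < θ := by rw [hθ]; apply div_pos <;> nlinarith
  obtain ⟨D, hD⟩ : ∃ D : ℝ, D = 1 + 2 * θ + 2 * (κ' * θ) := ⟨_, rfl⟩
  have hκθ : 0 < κ' * θ := by positivity
  have hD0 : 1 < D := by rw [hD]; linarith
  obtain ⟨ε, hε⟩ : ∃ ε : ℝ, ε = min e1 e2 / D := ⟨_, rfl⟩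
  have hm : 0 < min e1 e2 := lt_min he1 he2
  have hε0 : 0 < ε := by rw [hε]; positivity
  have hεD : ε * (1 + 2 * θ + 2 * (κ' * θ)) = min e1 e2 := by
    rw [← hD, hε]; field_simp
  have hεθ : 0 < ε * θ := by positivity
  have hεκθ : 0 < ε * (κ' * θ) := by positivity
  have hεm : ε ≤ min e1 e2 := by nlinarith
  have hεe1 : ε ≤ e1 := hεm.trans (min_le_left _ _)
  have hεe2 : ε ≤ e2 := hεm.trans (min_le_right _ _)
  refine ⟨ε, hε0, fun x u hx hu q hq hqε => ?_⟩
  have hxu := h1 x u (hx.trans_le hεe1) (hu.trans_le hεe1) q hq (hqε.trans_le hεe1)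
  rcases eq_or_ne x u with rfl | hne
  · simp
  have hH : 0 < ‖x - u‖ := norm_pos_iff.2 (sub_ne_zero.2 hne)
  have hH2 : ‖x - u‖ < 2 * ε := by
    have : x - u = (x - xb) - (u - xb) := by abel
    rw [this]
    linarith [norm_sub_le (x - xb) (u - xb)]
  have hy' : ‖q + θ • (x - u)‖ < min e1 e2 := by
    have := norm_add_le q (θ • (x - u))
    rw [norm_smul, Real.norm_of_nonneg hθ0.le] at this
    nlinarith
  obtain ⟨w, hw, hwu⟩ := h2 u (hu.trans_le hεe2) q hq (q + θ • (x - u))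
    (hy'.trans_le (min_le_right _ _)) (κ' * θ * ‖x - u‖) (by
      rw [add_sub_cancel_left, norm_smul, Real.norm_of_nonneg hθ0.le]
      have : 0 < θ * ‖x - u‖ := by positivity
      nlinarith)
  have hwxb : ‖w - xb‖ < e1 := by
    have : w - xb = (w - u) + (u - xb) := by abel
    rw [this]
    have h3 := norm_add_le (w - u) (u - xb)
    have h4 := min_le_left e1 e2
    nlinarith
  have hA := h1 w u hwxb (hu.trans_le hεe1) q hq (hqε.trans_le hεe1)
  have hB := h1 x w (hx.trans_le hεe1) hwxb _ hw (hy'.trans_le (min_le_left _ _))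
  have hC := h1 xb w (by simpa using he1) hwxb _ hw (hy'.trans_le (min_le_left _ _))
  have hC' := h1 xb u (by simpa using he1) (hu.trans_le hεe1) q hq (hqε.trans_le hεe1)
  by_cases hxt : f x = ⊤
  · rw [hxt]; exact le_top
  have hut : f u ≠ ⊤ := by
    intro h; rw [h, EReal.top_add_coe] at hC'; exact hfin (top_le_iff.1 hC')
  have hwt : f w ≠ ⊤ := by
    intro h; rw [h, EReal.top_add_coe] at hC; exact hfin (top_le_iff.1 hC)
  obtain ⟨a, ha⟩ := exists_real_of_ne hbot hxt
  obtain ⟨b, hb⟩ := exists_real_of_ne hbot hut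
  obtain ⟨c, hc⟩ := exists_real_of_ne hbot hwt
  rw [hb, hc] at hA
  rw [hc, ha] at hB
  rw [hb, ha]
  norm_cast at hA hB ⊢
  have hwdec : x - w = (x - u) - (w - u) := by abel
  rw [hwdec] at hB
  generalize x - u = h at *
  generalize w - u = v at *
  have hI : |⟪h, v⟫| ≤ ‖h‖ * ‖v‖ := abs_real_inner_le_norm h v
  have key := step_ineq hκ' hr hrκ hθ hH.le (norm_nonneg v) hwu.le hI
  rw [norm_sub_sq_real, inner_add_left, inner_smul_left, inner_sub_right, inner_sub_right,
    real_inner_self_eq_norm_sq] at hB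
  simp only [conj_trivial] at hB
  have e : (1 - r * κ') ^ 2 / (8 * κ') = (1 - r * κ') ^ 2 / (4 * κ') / 2 := by
    field_simp; ring
  rw [e] at key
  nlinarith

theorem growth_neg {f : X → EReal} (hbot : ∀ x, f x ≠ ⊥) {xb : X} (hfin : f xb ≠ ⊤)
    {κ r : ℝ} (hκ : 0 < κ) (hr : 0 ≤ r) (hrκ : r < κ⁻¹)
    (hsel : SelNear f xb κ) (hg : GrowthNear f xb r) :
    ∃ c : ℝ, 0 < c ∧ GrowthNear f xb (-c) := by
  have hrκ1 : r * κ < 1 := by rwa [inv_eq_one_div, lt_div_iff₀ hκ] at hrκ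
  obtain ⟨κ', hκκ, hrκ'⟩ : ∃ κ', κ < κ' ∧ r * κ' < 1 := by
    refine ⟨2 * κ / (1 + r * κ), ?_, ?_⟩
    · rw [lt_div_iff₀ (by positivity)]; nlinarith
    · rw [← mul_div_assoc, div_lt_one (by positivity)]; linarith
  have hκ' : 0 < κ' := hκ.trans hκκ
  obtain ⟨d, hd⟩ : ∃ d : ℝ, d = (1 - r * κ') ^ 2 / (4 * κ') := ⟨_, rfl⟩
  have hd0 : 0 < d := by
    have : 0 < 1 - r * κ' := by linarith
    rw [hd]; positivity
  by_contra hcon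
  push Not at hcon
  have hall : ∀ n : ℕ, GrowthNear f xb (r - n * d) := by
    intro n
    induction n with
    | zero => simpa using hg
    | succ n ih =>
      have hge : 0 ≤ r - n * d := by
        by_contra hlt
        push Not at hlt
        exact hcon (-(r - n * d)) (by linarith) (by rwa [neg_neg])
      have hnd : 0 ≤ (n : ℝ) * d := by positivity
      have hle : (r - n * d) * κ' ≤ r * κ' := by gcongr; linarith
      have := growth_step hbot hfin hκ hκκ hge (by linarith) hsel ih
      refine this.mono ?_
      have : d ≤ (1 - (r - n * d) * κ') ^ 2 / (4 * κ') := by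
        have h0 : 0 ≤ 1 - r * κ' := by linarith
        calc d = (1 - r * κ') ^ 2 / (4 * κ') := hd
          _ ≤ _ := by
            gcongr
      push_cast
      linarith
  obtain ⟨n, hn⟩ := exists_nat_gt (r / d)
  rw [div_lt_iff₀ hd0] at hn
  exact hcon (-(r - n * d)) (by linarith) (by rw [neg_neg]; exact hall n)

theorem tilt_of_growth {f : X → EReal} (hbot : ∀ x, f x ≠ ⊥) {xb : X} (hfin : f xb ≠ ⊤)
    (h0 : (0 : X) ∈ LimitingSubdiff f xb) {κ c : ℝ} (hκ : 0 < κ) (hc : 0 < c)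
    (hsel : SelNear f xb κ) (hg : GrowthNear f xb (-c)) : TiltStableWith f xb κ := by
  obtain ⟨e1, he1, h1⟩ := hg
  obtain ⟨e2, he2, h2⟩ := hsel
  obtain ⟨ε, hε⟩ : ∃ ε : ℝ, ε = min e1 e2 / 2 := ⟨_, rfl⟩
  have hm : 0 < min e1 e2 := lt_min he1 he2
  have hε0 : 0 < ε := by rw [hε]; positivity
  have hεe1 : ε < e1 := by rw [hε]; linarith [min_le_left e1 e2]
  have hεe2 : ε < e2 := by rw [hε]; linarith [min_le_right e1 e2]
  -- any nearby solution is the unique tilted minimizer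
  have hmin : ∀ u p : X, ‖u - xb‖ ≤ ε → ‖p‖ < ε → p ∈ LimitingSubdiff f u →
      TiltArgmin f xb ε p = {u} := by
    intro u p hu hp hpu
    have hin : ∀ x ∈ Metric.closedBall xb ε,
        f u + ((⟪p, x - u⟫ - (-c) / 2 * ‖x - u‖ ^ 2 : ℝ) : EReal) ≤ f x := by
      intro x hx
      rw [Metric.mem_closedBall, dist_eq_norm] at hx
      exact h1 x u (hx.trans_lt hεe1) (hu.trans_lt hεe1) p hpu (hp.trans hεe1)
    have hut : f u ≠ ⊤ := by
      intro h
      have := hin xb (Metric.mem_closedBall_self hε0.le)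
      rw [h, EReal.top_add_coe] at this
      exact hfin (top_le_iff.1 this)
    obtain ⟨b, hb⟩ := exists_real_of_ne hbot hut
    have humem : u ∈ Metric.closedBall xb ε := by
      rw [Metric.mem_closedBall, dist_eq_norm]; exact hu
    ext x
    constructor
    · rintro ⟨hx, hxm⟩
      have hA := hxm u humem
      have hB := hin x hx
      have hxt : f x ≠ ⊤ := by
        intro h
        rw [h, hb, EReal.top_sub_coe, ← EReal.coe_sub] at hA
        exact EReal.coe_ne_top _ (top_le_iff.1 hA)
      obtain ⟨a, ha⟩ := exists_real_of_ne hbot hxt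
      rw [ha, hb] at hA hB
      norm_cast at hA hB
      rw [inner_sub_right] at hB
      have : ‖x - u‖ ^ 2 ≤ 0 := by
        by_contra hlt
        push Not at hlt
        nlinarith
      have h0' : ‖x - u‖ = 0 := by
        have := sq_nonneg ‖x - u‖
        exact pow_eq_zero_iff (two_ne_zero) |>.1 (by linarith)
      exact sub_eq_zero.1 (norm_eq_zero.1 h0')
    · rintro rfl
      refine ⟨humem, fun y hy => ?_⟩
      have hB := hin y hy
      by_cases hyt : f y = ⊤
      · rw [hyt, EReal.top_sub_coe]; exact le_top
      obtain ⟨a, ha⟩ := exists_real_of_ne hbot hyt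
      rw [ha, hb] at hB ⊢
      norm_cast at hB ⊢
      rw [inner_sub_right] at hB
      have : 0 ≤ c * ‖y - x‖ ^ 2 := by positivity
      linarith
  obtain ⟨δ, hδ⟩ : ∃ δ : ℝ, δ = min ε (ε / (4 * (κ + 1))) := ⟨_, rfl⟩
  have hδ0 : 0 < δ := by rw [hδ]; apply lt_min hε0; positivity
  have hδε : δ ≤ ε := by rw [hδ]; exact min_le_left _ _
  have hδκ : (κ + 1) * δ ≤ ε / 4 := by
    have : δ ≤ ε / (4 * (κ + 1)) := by rw [hδ]; exact min_le_right _ _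
    rw [le_div_iff₀ (by positivity)] at this
    linarith
  have hex : ∀ p : X, ‖p‖ < δ → ∃ u : X, p ∈ LimitingSubdiff f u ∧ ‖u - xb‖ ≤ ε / 2 := by
    intro p hp
    obtain ⟨w, hw, hwu⟩ := h2 xb (by simpa using he2) 0 h0 p (by linarith) (ε / 2) (by
      rw [sub_zero]; nlinarith [norm_nonneg p])
    exact ⟨w, hw, hwu.le⟩
  choose! m hm1 hm2 using hex
  refine ⟨ε, hε0, Metric.ball 0 δ, Metric.ball_mem_nhds _ hδ0, m, ?_, ?_, ?_⟩
  · intro p hp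
    rw [mem_ball_zero_iff] at hp
    exact hmin _ _ (by linarith [hm2 p hp]) (by linarith) (hm1 p hp)
  · apply LipschitzOnWith.of_dist_le_mul
    intro p hp q hq
    rw [mem_ball_zero_iff] at hp hq
    rw [Real.coe_toNNReal _ hκ.le, dist_eq_norm, dist_eq_norm]
    by_contra hlt
    push Not at hlt
    have hpq : κ * ‖q - p‖ < min ‖m p - m q‖ (ε / 2) := by
      rw [norm_sub_rev]
      refine lt_min hlt ?_
      have := norm_sub_le p q
      nlinarith
    obtain ⟨w, hw, hwu⟩ := h2 (m p) (by linarith [hm2 p hp]) p (hm1 p hp) q (by linarith) _ hpq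
    have hw1 := hwu.trans_le (min_le_left _ _)
    have hw2 := hwu.trans_le (min_le_right _ _)
    have hwb : ‖w - xb‖ ≤ ε := by
      have : w - xb = (w - m p) + (m p - xb) := by abel
      rw [this]
      linarith [norm_add_le (w - m p) (m p - xb), hm2 p hp]
    have e1 := hmin w q hwb (by linarith) hw
    have e2 := hmin (m q) q (by linarith [hm2 q hq]) (by linarith) (hm1 q hq)
    rw [e1] at e2
    have : w = m q := Set.singleton_injective e2
    rw [this, norm_sub_rev] at hw1
    exact lt_irrefl _ hw1
  · have h0δ : ‖(0 : X)‖ < δ := by simpa using hδ0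
    have e1 := hmin (m 0) 0 (by linarith [hm2 0 h0δ]) (by simpa using hε0) (hm1 0 h0δ)
    have e2 := hmin xb 0 (by simpa using hε0.le) (by simpa using hε0) h0
    rw [e1] at e2
    exact Set.singleton_injective e2

/-- Local solvability of `p + s (m p - m 0) = z` for a monotone Lipschitz map `m`. -/
theorem exists_solution [CompleteSpace X] {m : X → X} {κ s ρ : ℝ} (hκ : 0 < κ) (hs : 0 < s)
    (hρ : 0 < ρ)
    (hlip : ∀ p q : X, ‖p‖ ≤ ρ → ‖q‖ ≤ ρ → ‖m p - m q‖ ≤ κ * ‖p - q‖)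
    (hmon : ∀ p q : X, ‖p‖ ≤ ρ → ‖q‖ ≤ ρ → 0 ≤ ⟪p - q, m p - m q⟫) :
    ∃ η : ℝ, 0 < η ∧ ∀ z : X, ‖z‖ ≤ η → ∃ p : X, ‖p‖ ≤ ρ ∧ p + s • (m p - m 0) = z := by
  obtain ⟨t, ht⟩ : ∃ t : ℝ, t = 1 / (1 + s ^ 2 * κ ^ 2) := ⟨_, rfl⟩
  have hden : 1 < 1 + s ^ 2 * κ ^ 2 := by
    have : 0 < s ^ 2 * κ ^ 2 := by positivity
    linarith
  have ht0 : 0 < t := by rw [ht]; positivity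
  have ht1 : t < 1 := by rw [ht, div_lt_one (by linarith)]; exact hden
  have htt : t * (1 + s ^ 2 * κ ^ 2) = 1 := by rw [ht]; field_simp
  obtain ⟨c, hc⟩ : ∃ c : ℝ, c = Real.sqrt (1 - t) := ⟨_, rfl⟩
  have hc0 : 0 ≤ c := by rw [hc]; positivity
  have hc2 : c ^ 2 = 1 - t := by rw [hc, Real.sq_sqrt (by linarith)]
  have hc1 : c < 1 := by nlinarith
  refine ⟨(1 - c) * ρ / t, div_pos (mul_pos (by linarith) hρ) ht0, fun z hz => ?_⟩
  have hz' : t * ‖z‖ ≤ (1 - c) * ρ := by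
    rw [le_div_iff₀ ht0] at hz; linarith
  let Φ : X → X := fun p => p - t • (p + s • (m p - m 0) - z)
  have hcontr : ∀ p q : X, ‖p‖ ≤ ρ → ‖q‖ ≤ ρ → ‖Φ p - Φ q‖ ≤ c * ‖p - q‖ := by
    intro p q hp hq
    have e : Φ p - Φ q = (1 - t) • (p - q) - (t * s) • (m p - m q) := by
      simp only [Φ]; module
    have h1 := hlip p q hp hq
    have h2 := hmon p q hp hq
    rw [e]
    generalize p - q = d at *
    generalize m p - m q = v at *
    apply le_of_sq_le_sq _ (by positivity)
    rw [norm_sub_sq_real, norm_smul, norm_smul, inner_smul_left, inner_smul_right, mul_pow,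
      mul_pow, mul_pow, hc2, Real.norm_of_nonneg (by linarith : 0 ≤ 1 - t),
      Real.norm_of_nonneg (by positivity : 0 ≤ t * s)]
    simp only [conj_trivial]
    have h3 : ‖v‖ ^ 2 ≤ κ ^ 2 * ‖d‖ ^ 2 := by
      rw [← mul_pow]; gcongr
    have h4 : (t * s) ^ 2 * ‖v‖ ^ 2 ≤ (t * s) ^ 2 * (κ ^ 2 * ‖d‖ ^ 2) := by gcongr
    have h5 : 0 ≤ (1 - t) * (t * s * ⟪d, v⟫) := by
      have : 0 ≤ 1 - t := by linarith
      positivity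
    have h6 : (1 - t) ^ 2 + (t * s) ^ 2 * κ ^ 2 = 1 - t := by
      linear_combination t * htt
    calc _ ≤ ((1 - t) ^ 2 + (t * s) ^ 2 * κ ^ 2) * ‖d‖ ^ 2 := by linarith
      _ = _ := by rw [h6]
  have hmaps : Set.MapsTo Φ (Metric.closedBall 0 ρ) (Metric.closedBall 0 ρ) := by
    intro p hp
    rw [mem_closedBall_zero_iff] at hp ⊢
    have h1 := hcontr p 0 hp (by simpa using hρ.le)
    have h2 : Φ 0 = t • z := by simp [Φ]
    have h3 : Φ p = (Φ p - Φ 0) + t • z := by rw [h2]; abel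
    rw [h3]
    have h4 := norm_add_le (Φ p - Φ 0) (t • z)
    rw [norm_smul, Real.norm_of_nonneg ht0.le] at h4
    rw [sub_zero] at h1
    nlinarith
  have hK : ContractingWith (Real.toNNReal c) (hmaps.restrict Φ _ _) := by
    refine ⟨by rw [← NNReal.coe_lt_coe, Real.coe_toNNReal _ hc0]; simpa using hc1, ?_⟩
    apply LipschitzWith.of_dist_le_mul
    rintro ⟨p, hp⟩ ⟨q, hq⟩
    rw [mem_closedBall_zero_iff] at hp hq
    rw [Real.coe_toNNReal _ hc0, Subtype.dist_eq, Subtype.dist_eq, dist_eq_norm, dist_eq_norm]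
    exact hcontr p q hp hq
  obtain ⟨p, hp, hfix, -⟩ := hK.exists_fixedPoint' (Metric.isClosed_closedBall.isComplete) hmaps
    (Metric.mem_closedBall_self hρ.le) (edist_ne_top _ _)
  rw [mem_closedBall_zero_iff] at hp
  refine ⟨p, hp, ?_⟩
  have hfix' : p - t • (p + s • (m p - m 0) - z) = p := hfix
  have : t • (p + s • (m p - m 0) - z) = 0 := by
    rwa [sub_eq_self] at hfix'
  rcases smul_eq_zero.1 this with h | h
  · exact absurd h ht0.ne'
  · exact sub_eq_zero.1 h

theorem forward_structure [CompleteSpace X] {f : X → EReal} (hbot : ∀ x, f x ≠ ⊥) {xb : X}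
    (hsc : SubdiffContAt f xb 0) {κ : ℝ} (hκ : 0 < κ)
    (hprox : ProxRegularAt f xb 0) (htilt : TiltStableWith f xb κ) :
    ∃ (m : X → X) (δ : ℝ), 0 < δ ∧ m 0 = xb ∧
      (∀ p q : X, ‖p‖ < δ → ‖q‖ < δ → ‖m p - m q‖ ≤ κ * ‖p - q‖) ∧
      (∀ p : X, ‖p‖ < δ → p ∈ LimitingSubdiff f (m p)) ∧
      (∀ p x : X, ‖p‖ < δ → ‖x - xb‖ < δ →
        f (m p) + ((⟪p, x - m p⟫ : ℝ) : EReal) ≤ f x) ∧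
      (∀ u q : X, ‖u - xb‖ < δ → ‖q‖ < δ → q ∈ LimitingSubdiff f u → u = m q) := by
  obtain ⟨hfin, r, hr, ε, hε, hprox⟩ := hprox
  obtain ⟨γ, hγ, V, hV, m, hm, hlip, hm0⟩ := htilt
  obtain ⟨e2, he2, hVb⟩ := Metric.mem_nhds_iff.1 hV
  obtain ⟨a0, ha0⟩ := exists_real_of_ne hbot hfin
  -- subdifferential continuity in epsilon form
  obtain ⟨e1, he1, hcont⟩ : ∃ e1 : ℝ, 0 < e1 ∧ ∀ u q : X, ‖u - xb‖ < e1 → ‖q‖ < e1 →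
      q ∈ LimitingSubdiff f u → f u ≤ f xb + (ε : EReal) ∧ f xb ≤ f u + (ε : EReal) := by
    have hnb : Set.Ioo ((a0 - ε : ℝ) : EReal) ((a0 + ε : ℝ) : EReal) ∈ 𝓝 (f xb) := by
      rw [ha0]
      apply Ioo_mem_nhds <;> norm_cast <;> linarith
    have := hsc hnb
    rw [Filter.mem_map, Metric.mem_nhdsWithin_iff] at this
    obtain ⟨e1, he1, h⟩ := this
    refine ⟨e1, he1, fun u q hu hq hqu => ?_⟩
    have hmem : ((u, q) : X × X) ∈ (fun q : X × X => f q.1) ⁻¹'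
        Set.Ioo ((a0 - ε : ℝ) : EReal) ((a0 + ε : ℝ) : EReal) := by
      apply h
      refine ⟨?_, hqu⟩
      rw [Metric.mem_ball, Prod.dist_eq, max_lt_iff]
      exact ⟨by simpa [dist_eq_norm] using hu, by simpa [dist_eq_norm] using hq⟩
    have hlo : ((a0 - ε : ℝ) : EReal) < f u := hmem.1
    have hhi : f u < ((a0 + ε : ℝ) : EReal) := hmem.2
    obtain ⟨b, hb⟩ := exists_real_of_ne hbot (ne_top_of_lt hhi)
    rw [hb] at hlo hhi ⊢
    rw [ha0]
    norm_cast at hlo hhi ⊢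
    constructor <;> linarith
  have hmV : ∀ p : X, ‖p‖ < e2 → p ∈ V := fun p hp => hVb (by rwa [mem_ball_zero_iff])
  have hL : ∀ p q : X, ‖p‖ < e2 → ‖q‖ < e2 → ‖m p - m q‖ ≤ κ * ‖p - q‖ := by
    intro p q hp hq
    have := hlip.dist_le_mul p (hmV p hp) q (hmV q hq)
    rwa [Real.coe_toNNReal _ hκ.le, dist_eq_norm, dist_eq_norm] at this
  have hL0 : ∀ p : X, ‖p‖ < e2 → ‖m p - xb‖ ≤ κ * ‖p‖ := by
    intro p hp
    have := hL p 0 hp (by simpa using he2)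
    rwa [hm0, sub_zero] at this
  have hmem : ∀ p : X, ‖p‖ < e2 → m p ∈ TiltArgmin f xb γ p := by
    intro p hp; rw [hm p (hmV p hp)]; exact Set.mem_singleton _
  have hmt : ∀ p : X, ‖p‖ < e2 → f (m p) ≠ ⊤ := by
    intro p hp h
    have := (hmem p hp).2 xb (Metric.mem_closedBall_self hγ.le)
    rw [h, ha0, EReal.top_sub_coe, ← EReal.coe_sub] at this
    exact EReal.coe_ne_top _ (top_le_iff.1 this)
  have hmin : ∀ p x : X, ‖p‖ < e2 → ‖x - xb‖ ≤ γ →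
      f (m p) + ((⟪p, x - m p⟫ : ℝ) : EReal) ≤ f x := by
    intro p x hp hx
    have h1 := (hmem p hp).2 x (by rwa [Metric.mem_closedBall, dist_eq_norm])
    by_cases hxt : f x = ⊤
    · rw [hxt]; exact le_top
    obtain ⟨a, ha⟩ := exists_real_of_ne hbot hxt
    obtain ⟨b, hb⟩ := exists_real_of_ne hbot (hmt p hp)
    rw [ha, hb] at h1 ⊢
    norm_cast at h1 ⊢
    rw [inner_sub_right]
    linarith
  have hmγ : ∀ p : X, ‖p‖ < e2 → ‖m p - xb‖ ≤ γ := by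
    intro p hp
    have := (hmem p hp).1
    rwa [Metric.mem_closedBall, dist_eq_norm] at this
  -- the radius for the solvability argument
  obtain ⟨ρ, hρ0, hρ2, hργ, hρε⟩ : ∃ ρ : ℝ, 0 < ρ ∧ ρ < e2 ∧ κ * ρ < γ ∧ κ * ρ < ε := by
    refine ⟨min (e2 / 2) (min (γ / (2 * κ)) (ε / (2 * κ))), by positivity, ?_, ?_, ?_⟩
    · exact (min_le_left _ _).trans_lt (by linarith)
    · calc κ * _ ≤ κ * (γ / (2 * κ)) := by
            gcongr; exact (min_le_right _ _).trans (min_le_left _ _)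
        _ = γ / 2 := by field_simp
        _ < γ := by linarith
    · calc κ * _ ≤ κ * (ε / (2 * κ)) := by
            gcongr; exact (min_le_right _ _).trans (min_le_right _ _)
        _ = ε / 2 := by field_simp
        _ < ε := by linarith
  have hmon : ∀ p q : X, ‖p‖ ≤ ρ → ‖q‖ ≤ ρ → 0 ≤ ⟪p - q, m p - m q⟫ := by
    intro p q hp hq
    have hp' := hp.trans_lt hρ2
    have hq' := hq.trans_lt hρ2
    have h1 := hmin p (m q) hp' (hmγ q hq')
    have h2 := hmin q (m p) hq' (hmγ p hp')
    obtain ⟨a, ha⟩ := exists_real_of_ne hbot (hmt p hp')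
    obtain ⟨b, hb⟩ := exists_real_of_ne hbot (hmt q hq')
    rw [ha, hb] at h1 h2
    norm_cast at h1 h2
    rw [inner_sub_right] at h1 h2
    rw [inner_sub_left, inner_sub_right, inner_sub_right]
    linarith
  obtain ⟨η, hη, hsol⟩ := exists_solution hκ hr hρ0
    (fun p q hp hq => hL p q (hp.trans_lt hρ2) (hq.trans_lt hρ2)) hmon
  obtain ⟨δ, hδ⟩ : ∃ δ : ℝ, δ = min (min (min ρ γ) (min ε e1)) (η / (1 + r)) := ⟨_, rfl⟩
  have hδ0 : 0 < δ := by rw [hδ]; positivity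
  have hδρ : δ ≤ ρ := by
    rw [hδ]; exact (min_le_left _ _).trans ((min_le_left _ _).trans (min_le_left _ _))
  have hδγ : δ ≤ γ := by
    rw [hδ]; exact (min_le_left _ _).trans ((min_le_left _ _).trans (min_le_right _ _))
  have hδε : δ ≤ ε := by
    rw [hδ]; exact (min_le_left _ _).trans ((min_le_right _ _).trans (min_le_left _ _))
  have hδe1 : δ ≤ e1 := by
    rw [hδ]; exact (min_le_left _ _).trans ((min_le_right _ _).trans (min_le_right _ _))
  have hδη : δ * (1 + r) ≤ η := by
    have : δ ≤ η / (1 + r) := by rw [hδ]; exact min_le_right _ _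
    rwa [le_div_iff₀ (by positivity)] at this
  refine ⟨m, δ, hδ0, hm0, fun p q hp hq => hL p q (by linarith) (by linarith), ?_,
    fun p x hp hx => hmin p x (by linarith) (by linarith), ?_⟩
  · intro p hp
    have hp2 : ‖p‖ < e2 := by linarith
    apply frechet_subset_limiting
    refine ⟨hmt p hp2, fun e he => ⟨γ - κ * ρ, by linarith, fun y hy => ?_⟩⟩
    have h1 : ‖m p - xb‖ ≤ κ * ρ := (hL0 p hp2).trans (by gcongr; linarith)
    have h2 : ‖y - xb‖ ≤ γ := by
      have : y - xb = (y - m p) + (m p - xb) := by abel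
      rw [this]
      linarith [norm_add_le (y - m p) (m p - xb)]
    refine le_trans ?_ (hmin p y hp2 h2)
    gcongr
    have : 0 ≤ e * ‖y - m p‖ := by positivity
    linarith
  · intro u q hu hq hqu
    obtain ⟨p, hp, hpz⟩ := hsol (q + r • (u - xb)) (by
      have := norm_add_le q (r • (u - xb))
      rw [norm_smul, Real.norm_of_nonneg hr.le] at this
      nlinarith)
    rw [hm0] at hpz
    have hp2 : ‖p‖ < e2 := by linarith
    obtain ⟨hc1, hc2⟩ := hcont u q (by linarith) (by linarith) hqu
    have hmpε : m p ∈ Metric.closedBall xb ε := by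
      rw [Metric.mem_closedBall, dist_eq_norm]
      have : κ * ‖p‖ ≤ κ * ρ := by gcongr
      linarith [hL0 p hp2]
    have h1 := hprox (m p) hmpε u (by rw [Metric.mem_closedBall, dist_eq_norm]; linarith)
      hc1 hc2 q hqu (by rw [mem_closedBall_zero_iff]; linarith)
    have h2 := hmin p u hp2 (by linarith)
    have hut : f u ≠ ⊤ := by
      intro h
      rw [h, ha0] at hc1
      have : (⊤ : EReal) ≤ ((a0 + ε : ℝ) : EReal) := by rw [EReal.coe_add]; exact hc1
      exact EReal.coe_ne_top _ (top_le_iff.1 this)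
    obtain ⟨a, ha⟩ := exists_real_of_ne hbot hut
    obtain ⟨b, hb⟩ := exists_real_of_ne hbot (hmt p hp2)
    rw [ha, hb] at h1 h2
    norm_cast at h1 h2
    have hqp : q = p + r • (m p - u) := by
      have : q = (p + r • (m p - xb)) - r • (u - xb) := by rw [hpz]; abel
      rw [this]; module
    have hneg : u - m p = -(m p - u) := by abel
    rw [hneg, inner_neg_right] at h2
    rw [hqp, inner_add_left, inner_smul_left, real_inner_self_eq_norm_sq] at h1
    simp only [conj_trivial] at h1
    have hz : ‖m p - u‖ ^ 2 ≤ 0 := by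
      by_contra hlt
      push Not at hlt
      nlinarith
    have hz' : ‖m p - u‖ = 0 :=
      (pow_eq_zero_iff two_ne_zero).1 (le_antisymm hz (sq_nonneg _))
    have hmu : m p - u = 0 := norm_eq_zero.1 hz'
    rw [hmu, smul_zero, add_zero] at hqp
    rw [hqp]
    exact (sub_eq_zero.1 hmu).symm

/-- Proposition 4.5: tilt stability via metric regularity of the subdifferential
in Hilbert spaces. -/
theorem tilt_stability_via_metric_regularity {X : Type*} [NormedAddCommGroup X] [InnerProductSpace ℝ X] [CompleteSpace X]
    (f : X → EReal)
    (hproper : ∃ x, f x ≠ ⊤) (hbot : ∀ x, f x ≠ ⊥) (hlsc : LowerSemicontinuous f)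
    (xb : X) (h0 : (0 : X) ∈ LimitingSubdiff f xb)
    (hsc : SubdiffContAt f xb 0) (κ : ℝ) (hκ : 0 < κ) :
    (ProxRegularAt f xb 0 ∧ TiltStableWith f xb κ) ↔
    (MetricallyRegularAround (LimitingSubdiff f) xb (0 : X) κ ∧
      ∃ r : ℝ, 0 ≤ r ∧ r < κ⁻¹ ∧ ∃ U ∈ 𝓝 xb, ∃ Us ∈ 𝓝 (0 : X),
        ∀ x ∈ U, ∀ u ∈ U, ∀ q ∈ LimitingSubdiff f u, q ∈ Us →
          f u + ((⟪q, x - u⟫ - r / 2 * ‖x - u‖ ^ 2 : ℝ) : EReal) ≤ f x) := by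
  constructor
  · rintro ⟨hprox, htilt⟩
    obtain ⟨m, δ, hδ, hm0, hL, hF, hmin, huniq⟩ := forward_structure hbot hsc hκ hprox htilt
    constructor
    · obtain ⟨η, hη0, hη1, hη2⟩ : ∃ η : ℝ, 0 < η ∧ η ≤ δ / 2 ∧ η * (1 + κ) ≤ κ * (δ / 2) := by
        refine ⟨min (δ / 2) (κ * (δ / 2) / (1 + κ)), by positivity, min_le_left _ _, ?_⟩
        rw [← le_div_iff₀ (by positivity)]
        exact min_le_right _ _
      refine ⟨Metric.ball xb η, Metric.ball_mem_nhds _ hη0, Metric.ball 0 η,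
        Metric.ball_mem_nhds _ hη0, fun x hx y hy => ?_⟩
      rw [Metric.mem_ball, dist_eq_norm] at hx
      rw [mem_ball_zero_iff] at hy
      have hyδ : ‖y‖ < δ := by linarith
      have hmy := hF y hyδ
      have hb : ∀ w ∈ LimitingSubdiff f x, ‖x - m y‖ ≤ κ * ‖y - w‖ := by
        intro w hw
        by_cases hwδ : ‖w‖ < δ
        · have := huniq x w (by linarith) hwδ hw
          rw [this, norm_sub_rev y w]
          exact hL w y hwδ hyδ
        · push Not at hwδ
          have h1 : ‖m y - xb‖ ≤ κ * ‖y‖ := by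
            have := hL y 0 hyδ (by simpa using hδ)
            rwa [hm0, sub_zero] at this
          have h2 : δ / 2 ≤ ‖y - w‖ := by
            have := norm_sub_norm_le w y
            rw [norm_sub_rev] at this
            linarith
          have h3 : ‖x - m y‖ ≤ ‖x - xb‖ + ‖m y - xb‖ := by
            have : x - m y = (x - xb) - (m y - xb) := by abel
            rw [this]; exact norm_sub_le _ _
          have h4 : κ * ‖y‖ ≤ κ * η := by gcongr
          have h5 : κ * (δ / 2) ≤ κ * ‖y - w‖ := by gcongr
          linarith
      have hκ0 : ENNReal.ofReal κ ≠ 0 := by simpa using hκ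
      calc Metric.infEDist x {z | y ∈ LimitingSubdiff f z} ≤ edist x (m y) :=
            Metric.infEDist_le_edist_of_mem hmy
        _ ≤ ENNReal.ofReal κ * Metric.infEDist y (LimitingSubdiff f x) := by
            rw [mul_comm, ← ENNReal.div_le_iff_le_mul (Or.inl hκ0) (Or.inl ENNReal.ofReal_ne_top),
              Metric.le_infEDist]
            intro w hw
            rw [ENNReal.div_le_iff_le_mul (Or.inl hκ0) (Or.inl ENNReal.ofReal_ne_top), mul_comm,
              edist_dist, edist_dist, ← ENNReal.ofReal_mul hκ.le, dist_eq_norm, dist_eq_norm]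
            exact ENNReal.ofReal_le_ofReal (hb w hw)
    · refine ⟨0, le_rfl, by positivity, Metric.ball xb δ, Metric.ball_mem_nhds _ hδ,
        Metric.ball 0 δ, Metric.ball_mem_nhds _ hδ, fun x hx u hu q hq hqδ => ?_⟩
      rw [Metric.mem_ball, dist_eq_norm] at hx hu
      rw [mem_ball_zero_iff] at hqδ
      have hum := huniq u q hu hqδ hq
      have := hmin q x hqδ hx
      rw [← hum] at this
      simpa using this
  · rintro ⟨hreg, r, hr, hrκ, U, hU, Us, hUs, hineq⟩
    have hfin : f xb ≠ ⊤ := by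
      intro htop
      have h0' := h0
      obtain ⟨xs, ps, hps, hxs, -, -⟩ := h0'
      obtain ⟨k, hk⟩ := (hxs.eventually_mem hU).exists
      have := hineq (xs k) hk xb (mem_of_mem_nhds hU) 0 h0 (mem_of_mem_nhds hUs)
      rw [htop, EReal.top_add_coe] at this
      exact (hps k).1 (top_le_iff.1 this)
    have hg : GrowthNear f xb r := by
      obtain ⟨e1, he1, h1⟩ := Metric.mem_nhds_iff.1 hU
      obtain ⟨e2, he2, h2⟩ := Metric.mem_nhds_iff.1 hUs
      refine ⟨min e1 e2, lt_min he1 he2, fun x u hx hu q hq hqε => ?_⟩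
      refine hineq x (h1 ?_) u (h1 ?_) q hq (h2 ?_)
      · rw [Metric.mem_ball, dist_eq_norm]; exact hx.trans_le (min_le_left _ _)
      · rw [Metric.mem_ball, dist_eq_norm]; exact hu.trans_le (min_le_left _ _)
      · rw [mem_ball_zero_iff]; exact hqε.trans_le (min_le_right _ _)
    have hsel := selNear_of_metricallyRegular hκ hreg
    constructor
    · obtain ⟨ε, hε, h⟩ := hg.mono (by linarith : r ≤ r + 1)
      refine ⟨hfin, r + 1, by linarith, ε / 2, by linarith,
        fun x hx u hu _ _ p hp hpε => h x u ?_ ?_ p hp ?_⟩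
      · rw [Metric.mem_closedBall, dist_eq_norm] at hx; linarith
      · rw [Metric.mem_closedBall, dist_eq_norm] at hu; linarith
      · rw [mem_closedBall_zero_iff] at hpε; linarith
    · obtain ⟨c, hc, hgc⟩ := growth_neg hbot hfin hκ hr hrκ hsel hg
      exact tilt_of_growth hbot hfin h0 hκ hc hsel hgc
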